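/- Fix a probability measure π on Θ. For every posterior distribution ω ↦ ρ_ω and every positive real constant λ, P[ ρ_ω(R) ] ≤ ( 1 − exp( −N^{-1} ( λ P[ρ_ω(r(·,ω))] + P[K(ρ_ω,π)] ) ) ) / ( 1 − exp(−λ/N) ) ≤ P[ ( λ / ( N (1 − exp(−λ/N)) ) ) ( ρ_ω(r(·,ω)) + K(ρ_ω,π)/λ ) ]. -/

import Mathlib

open MeasureTheory ProbabilityTheory

/-- `Φ_a(p) = -a⁻¹ log(1 - (1 - e^{-a}) p)` for `a ≠ 0`, and `Φ_0(p) = p`. -/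
noncomputable def Phi (a p : ℝ) : ℝ :=
  if a = 0 then p else -a⁻¹ * Real.log (1 - (1 - Real.exp (-a)) * p)

/-- `Φ_a⁻¹(q) = (1 - e^{-aq})/(1 - e^{-a})` for `a ≠ 0`, and `Φ_0⁻¹(q) = q`. -/
noncomputable def PhiInv (a q : ℝ) : ℝ :=
  if a = 0 then q else (1 - Real.exp (-(a * q))) / (1 - Real.exp (-a))

/-- Kullback–Leibler divergence `K(ρ,π) = ∫ log (dρ/dπ) dρ` (as a real number;
meaningful under `KLFin ρ π`). -/
noncomputable def KL {Θ : Type*} [MeasurableSpace Θ] (ρ π : Measure Θ) : ℝ :=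
  ∫ θ, Real.log ((ρ.rnDeriv π θ).toReal) ∂ρ

/-- Finiteness of the Kullback–Leibler divergence: `ρ ≪ π` and `log (dρ/dπ)`
is `ρ`-integrable. -/
def KLFin {Θ : Type*} [MeasurableSpace Θ] (ρ π : Measure Θ) : Prop :=
  ρ ≪ π ∧ Integrable (fun θ => Real.log ((ρ.rnDeriv π θ).toReal)) ρ

/-- The Gibbs measure `π_{exp h}` with density `exp h / π[exp h]` with respect to `π`. -/
noncomputable def Gibbs {Θ : Type*} [MeasurableSpace Θ] (π : Measure Θ) (h : Θ → ℝ) :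
    Measure Θ :=
  (ENNReal.ofReal (∫ θ, Real.exp (h θ) ∂π))⁻¹ •
    π.withDensity (fun θ => ENNReal.ofReal (Real.exp (h θ)))

/-- Empirical error rate `r(θ,ω) = N⁻¹ ∑ᵢ 1[f_θ(X_i) ≠ Y_i]`. -/
noncomputable def empErr {𝒳 𝒴 Θ : Type*} [DecidableEq 𝒴] (N : ℕ)
    (f : Θ → 𝒳 → 𝒴) (θ : Θ) (ω : Fin N → 𝒳 × 𝒴) : ℝ :=
  (N : ℝ)⁻¹ * ∑ i, if f θ (ω i).1 = (ω i).2 then 0 else 1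

/-- Expected error rate `R(θ) = N⁻¹ ∑ᵢ P[f_θ(X_i) ≠ Y_i]`. -/
noncomputable def expErr {𝒳 𝒴 Θ : Type*} [MeasurableSpace 𝒳] [MeasurableSpace 𝒴] (N : ℕ)
    (P : Measure (Fin N → 𝒳 × 𝒴)) (f : Θ → 𝒳 → 𝒴) (θ : Θ) : ℝ :=
  (N : ℝ)⁻¹ * ∑ i, (P {ω | f θ (ω i).1 ≠ (ω i).2}).toReal

/-- Weak form of the Donsker–Varadhan variational inequality. -/
theorem integral_le_KL_add_integral_exp {Θ : Type*} [MeasurableSpace Θ] {μ π : Measure Θ}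
    [IsProbabilityMeasure μ] [IsProbabilityMeasure π] (hμ : KLFin μ π) {g : Θ → ℝ}
    (hg : Integrable g μ) (hexp : Integrable (fun θ => Real.exp (g θ)) π) :
    ∫ θ, g θ ∂μ ≤ KL μ π + (∫ θ, Real.exp (g θ) ∂π - 1) := by
  obtain ⟨hac, hint⟩ := hμ
  have := isProbabilityMeasure_tilted hexp
  have hgibbs := InformationTheory.integral_llr_add_sub_measure_univ_nonneg
    (hac.trans (absolutelyContinuous_tilted hexp)) (integrable_llr_tilted_right hac hg hint hexp)
  rw [integral_llr_tilted_right hac hg hexp hint] at hgibbs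
  have hlog := Real.log_le_sub_one_of_pos (integral_exp_pos hexp)
  simp only [probReal_univ] at hgibbs
  change ∫ θ, g θ ∂μ ≤ ∫ θ, llr μ π θ ∂μ + _
  linarith

theorem MeasureTheory.Integrable.integral_measure_compProd {Ω Θ : Type*}
    [MeasurableSpace Ω] [MeasurableSpace Θ] {P : Measure Ω} [SFinite P] {ρ : Kernel Ω Θ}
    [IsSFiniteKernel ρ] {g : Ω × Θ → ℝ} (hg : Integrable g (P ⊗ₘ ρ)) :
    Integrable (fun ω => ∫ θ, g (ω, θ) ∂(ρ ω)) P := by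
  simpa using Integrable.integral_compProd (κ := Kernel.const Unit P)
    (η := Kernel.prodMkLeft Unit ρ) (a := ()) hg

/-- A random function whose exponential moments are at most one has posterior mean at most
the mean divergence of the posterior from the prior. -/
theorem integral_integral_le_integral_KL {Ω Θ : Type*} [MeasurableSpace Ω] [MeasurableSpace Θ]
    {P : Measure Ω} [IsProbabilityMeasure P] {π : Measure Θ} [IsProbabilityMeasure π]
    {ρ : Kernel Ω Θ} [IsMarkovKernel ρ] (hρ : ∀ᵐ ω ∂P, KLFin (ρ ω) π)
    (hKLint : Integrable (fun ω => KL (ρ ω) π) P)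
    {g : Ω × Θ → ℝ} (hg : Measurable g) {C : ℝ} (hgC : ∀ z, |g z| ≤ C)
    (hexp : ∀ θ, ∫ ω, Real.exp (g (ω, θ)) ∂P ≤ 1) :
    ∫ ω, ∫ θ, g (ω, θ) ∂(ρ ω) ∂P ≤ ∫ ω, KL (ρ ω) π ∂P := by
  have hbound : ∀ z, ‖Real.exp (g z)‖ ≤ Real.exp C := fun z => by
    rw [Real.norm_eq_abs, Real.abs_exp]
    exact Real.exp_le_exp.2 ((le_abs_self _).trans (hgC z))
  have hE : Integrable (fun z => Real.exp (g z)) (P.prod π) :=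
    .of_bound hg.exp.aestronglyMeasurable _ (ae_of_all _ hbound)
  have hG : Integrable g (P ⊗ₘ ρ) := .of_bound hg.aestronglyMeasurable C (ae_of_all _ hgC)
  have hpoint : ∀ᵐ ω ∂P, ∫ θ, g (ω, θ) ∂(ρ ω) ≤
      KL (ρ ω) π + (∫ θ, Real.exp (g (ω, θ)) ∂π - 1) := by
    filter_upwards [hρ] with ω hω
    have hgω : Measurable fun θ => g (ω, θ) := hg.comp measurable_prodMk_left
    exact integral_le_KL_add_integral_exp hω
      (.of_bound hgω.aestronglyMeasurable C (ae_of_all _ fun θ => hgC _))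
      (.of_bound hgω.exp.aestronglyMeasurable _ (ae_of_all _ fun θ => hbound _))
  have hEint := hE.integral_prod_left.sub (integrable_const (1 : ℝ))
  have hswap : ∫ ω, ∫ θ, Real.exp (g (ω, θ)) ∂π ∂P ≤ 1 := by
    rw [integral_integral_swap hE]
    calc _ ≤ ∫ _, (1 : ℝ) ∂π := integral_mono hE.integral_prod_right (integrable_const _) hexp
      _ = 1 := by simp
  have hmono := integral_mono_ae hG.integral_measure_compProd (hKLint.add hEint) hpoint
  have hsplit := integral_add hKLint hEint
  have hsub := integral_sub hE.integral_prod_left (integrable_const (1 : ℝ))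
  simp only [Pi.sub_apply, Pi.add_apply, integral_const, probReal_univ, smul_eq_mul,
    mul_one] at hmono hsplit hsub
  linarith

/-- Jensen's inequality for the logarithm of a bounded function with positive lower bound. -/
theorem integral_log_le_log_integral {α : Type*} [MeasurableSpace α] {μ : Measure α}
    [IsProbabilityMeasure μ] {X : α → ℝ} {a b : ℝ} (ha : 0 < a) (hX : Measurable X)
    (hXab : ∀ x, X x ∈ Set.Icc a b) :
    ∫ x, Real.log (X x) ∂μ ≤ Real.log (∫ x, X x ∂μ) := by
  have hsub : Set.Icc a b ⊆ Set.Ioi 0 := fun x hx => ha.trans_le hx.1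
  refine (strictConcaveOn_log_Ioi.concaveOn.subset hsub (convex_Icc a b)).le_map_integral
    (Real.continuousOn_log.mono fun x hx => (hsub hx).ne') isClosed_Icc (ae_of_all _ hXab)
    (.of_mem_Icc a b hX.aemeasurable (ae_of_all _ hXab))
    (.of_mem_Icc (Real.log a) (Real.log b) hX.log.aemeasurable (ae_of_all _ fun x => ?_))
  have hpos := ha.trans_le (hXab x).1
  exact ⟨Real.log_le_log ha (hXab x).1, Real.log_le_log hpos (hXab x).2⟩

/-- Inequality of arithmetic and geometric means, as a bound on the product of `N` numbers
with arithmetic mean `m`. -/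
theorem prod_le_pow_of_sum_eq {N : ℕ} {y : Fin N → ℝ} {m : ℝ} (hy : ∀ i, 0 ≤ y i) (hm : 0 < m)
    (hsum : ∑ i, y i = N * m) : ∏ i, y i ≤ m ^ N := by
  have hle : ∏ i, y i / m ≤ ∏ i, Real.exp (y i / m - 1) :=
    Finset.prod_le_prod (fun i _ => div_nonneg (hy i) hm.le)
      fun i _ => by linarith [Real.add_one_le_exp (y i / m - 1)]
  have hone : ∏ i, Real.exp (y i / m - 1) = 1 := by
    rw [← Real.exp_sum, Finset.sum_sub_distrib, ← Finset.sum_div, hsum]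
    simp [hm.ne']
  rw [hone, Finset.prod_div_distrib, Finset.prod_const, Finset.card_univ, Fintype.card_fin,
    div_le_one (by positivity)] at hle
  exact hle

section Errors

variable {𝒳 𝒴 Θ : Type*} {N : ℕ} {f : Θ → 𝒳 → 𝒴}

theorem empErr_mem_Icc [DecidableEq 𝒴] (θ : Θ) (ω : Fin N → 𝒳 × 𝒴) :
    empErr N f θ ω ∈ Set.Icc (0 : ℝ) 1 := by
  have h0 : ∀ i, (0 : ℝ) ≤ if f θ (ω i).1 = (ω i).2 then 0 else 1 := fun i => by
    split_ifs <;> norm_num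
  have h1 : ∀ i, (if f θ (ω i).1 = (ω i).2 then 0 else 1) ≤ (1 : ℝ) := fun i => by
    split_ifs <;> norm_num
  refine ⟨mul_nonneg (by positivity) (Finset.sum_nonneg fun i _ => h0 i), ?_⟩
  refine inv_mul_le_one_of_le₀ ?_ (by positivity)
  simpa using Finset.sum_le_sum fun i (_ : i ∈ Finset.univ) => h1 i

variable [MeasurableSpace 𝒳] [MeasurableSpace 𝒴]

theorem expErr_mem_Icc {P : Measure (Fin N → 𝒳 × 𝒴)} [IsProbabilityMeasure P] (θ : Θ) :
    expErr N P f θ ∈ Set.Icc (0 : ℝ) 1 := by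
  refine ⟨mul_nonneg (by positivity) (Finset.sum_nonneg fun i _ => ENNReal.toReal_nonneg), ?_⟩
  refine inv_mul_le_one_of_le₀ ?_ (by positivity)
  simpa [measureReal_def] using Finset.sum_le_sum fun i (_ : i ∈ Finset.univ) =>
    (measureReal_le_one (μ := P) (s := {ω | f θ (ω i).1 ≠ (ω i).2}))

variable [MeasurableSpace Θ] [Fintype 𝒴] [MeasurableSingletonClass 𝒴]

theorem measurableSet_eq_label (hf : Measurable fun p : Θ × 𝒳 => f p.1 p.2) (i : Fin N) :
    MeasurableSet {z : (Fin N → 𝒳 × 𝒴) × Θ | f z.2 (z.1 i).1 = (z.1 i).2} :=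
  measurableSet_eq_fun
    (hf.comp (by fun_prop : Measurable fun z : (Fin N → 𝒳 × 𝒴) × Θ => (z.2, (z.1 i).1)))
    (by fun_prop)

theorem measurable_empErr [DecidableEq 𝒴] (hf : Measurable fun p : Θ × 𝒳 => f p.1 p.2) :
    Measurable fun z : (Fin N → 𝒳 × 𝒴) × Θ => empErr N f z.2 z.1 :=
  (Finset.measurable_fun_sum _ fun i _ => Measurable.ite (measurableSet_eq_label hf i)
    measurable_const measurable_const).const_mul _

theorem measurable_expErr {P : Measure (Fin N → 𝒳 × 𝒴)} [IsProbabilityMeasure P]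
    (hf : Measurable fun p : Θ × 𝒳 => f p.1 p.2) : Measurable (expErr N P f) :=
  (Finset.measurable_fun_sum _ fun i _ =>
    (measurable_measure_prodMk_right (measurableSet_eq_label hf i).compl).ennreal_toReal).const_mul _

theorem integral_exp_neg_ite [DecidableEq 𝒴] {μ : Measure (𝒳 × 𝒴)} [IsProbabilityMeasure μ]
    {h : 𝒳 → 𝒴} (hh : Measurable h) (a : ℝ) :
    ∫ z, Real.exp (-a * if h z.1 = z.2 then 0 else 1) ∂μ
      = 1 - (1 - Real.exp (-a)) * μ.real {z | h z.1 ≠ z.2} := by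
  have hs : MeasurableSet {z : 𝒳 × 𝒴 | h z.1 ≠ z.2} :=
    (measurableSet_eq_fun (hh.comp measurable_fst) measurable_snd).compl
  have heq : ∀ z : 𝒳 × 𝒴, Real.exp (-a * if h z.1 = z.2 then 0 else 1)
      = 1 - {z : 𝒳 × 𝒴 | h z.1 ≠ z.2}.indicator (fun _ => 1 - Real.exp (-a)) z := fun z => by
    by_cases hz : h z.1 = z.2 <;> simp [hz]
  simp_rw [heq]
  rw [integral_sub (integrable_const _) ((integrable_const _).indicator hs),
    integral_indicator_const _ hs]
  simp [mul_comm]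

/-- Exponential moment bound for the empirical error rate. -/
theorem integral_exp_neg_empErr_le [DecidableEq 𝒴] (hN : 0 < N) {Ps : Fin N → Measure (𝒳 × 𝒴)}
    [∀ i, IsProbabilityMeasure (Ps i)] (hf : Measurable fun p : Θ × 𝒳 => f p.1 p.2)
    {lam : ℝ} (hlam : 0 < lam) (θ : Θ) :
    ∫ ω, Real.exp (-lam * empErr N f θ ω) ∂(Measure.pi Ps)
      ≤ (1 - (1 - Real.exp (-(lam / N))) * expErr N (Measure.pi Ps) f θ) ^ N := by
  have hN' : (0 : ℝ) < N := Nat.cast_pos.2 hN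
  have hθ : Measurable (f θ) := hf.comp measurable_prodMk_left
  have hs : MeasurableSet {z : 𝒳 × 𝒴 | f θ z.1 ≠ z.2} :=
    (measurableSet_eq_fun (hθ.comp measurable_fst) measurable_snd).compl
  have hc : Real.exp (-(lam / N)) < 1 := Real.exp_lt_one_iff.2 (neg_lt_zero.2 (by positivity))
  have heval : ∀ i, (Measure.pi Ps {ω | f θ (ω i).1 ≠ (ω i).2}).toReal
      = (Ps i).real {z | f θ z.1 ≠ z.2} := fun i =>
    congrArg ENNReal.toReal
      ((measurePreserving_eval Ps i).measure_preimage hs.nullMeasurableSet)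
  have hexp : ∀ ω : Fin N → 𝒳 × 𝒴, Real.exp (-lam * empErr N f θ ω)
      = ∏ i, Real.exp (-(lam / N) * if f θ (ω i).1 = (ω i).2 then 0 else 1) := fun ω => by
    rw [← Real.exp_sum, ← Finset.mul_sum, empErr]
    ring_nf
  simp_rw [hexp]
  rw [integral_fintype_prod_eq_prod (μ := Ps)
    (fun (_ : Fin N) z => Real.exp (-(lam / N) * if f θ z.1 = z.2 then 0 else 1))]
  simp_rw [integral_exp_neg_ite hθ]
  have hR := expErr_mem_Icc (f := f) (P := Measure.pi Ps) θ
  refine prod_le_pow_of_sum_eq (fun i => ?_) ?_ ?_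
  · have := measureReal_le_one (μ := Ps i) (s := {z | f θ z.1 ≠ z.2})
    nlinarith [Real.exp_pos (-(lam / N))]
  · nlinarith [Real.exp_pos (-(lam / N)), hR.2]
  · simp_rw [expErr, heval]
    rw [Finset.sum_sub_distrib, ← Finset.mul_sum]
    simp
    field_simp

end Errors

/-- Unbiased empirical bound (Theorem `thm2.4` of Catoni): for every posterior `ρ`
and every `λ > 0`,
`P[ρ(R)] ≤ (1 - exp(-N⁻¹ P[λ ρ(r) + K(ρ,π)])) / (1 - exp(-λ/N))
        ≤ P[(λ/(N(1-exp(-λ/N)))) (ρ(r) + K(ρ,π)/λ)]`. -/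
theorem statement_3 {𝒳 𝒴 Θ : Type*} [MeasurableSpace 𝒳] [MeasurableSpace 𝒴]
    [Fintype 𝒴] [DecidableEq 𝒴] [MeasurableSingletonClass 𝒴] [MeasurableSpace Θ]
    (N : ℕ) (hN : 0 < N)
    (Ps : Fin N → Measure (𝒳 × 𝒴)) [∀ i, IsProbabilityMeasure (Ps i)]
    (P : Measure (Fin N → 𝒳 × 𝒴)) [IsProbabilityMeasure P] (hP : P = Measure.pi Ps)
    (f : Θ → 𝒳 → 𝒴) (hf : Measurable fun p : Θ × 𝒳 => f p.1 p.2)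
    (π : Measure Θ) [IsProbabilityMeasure π] (lam : ℝ) (hlam : 0 < lam)
    (ρ : Kernel (Fin N → 𝒳 × 𝒴) Θ) [IsMarkovKernel ρ]
    (hρ : ∀ᵐ ω ∂P, KLFin (ρ ω) π)
    (hKLint : Integrable (fun ω => KL (ρ ω) π) P) :
    (∫ ω, (∫ θ, expErr N P f θ ∂(ρ ω)) ∂P
        ≤ (1 - Real.exp (-(N : ℝ)⁻¹ *
              (∫ ω, (lam * (∫ θ, empErr N f θ ω ∂(ρ ω)) + KL (ρ ω) π) ∂P)))
          / (1 - Real.exp (-(lam / N))))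
    ∧ ((1 - Real.exp (-(N : ℝ)⁻¹ *
              (∫ ω, (lam * (∫ θ, empErr N f θ ω ∂(ρ ω)) + KL (ρ ω) π) ∂P)))
          / (1 - Real.exp (-(lam / N)))
        ≤ ∫ ω, (lam / (N * (1 - Real.exp (-(lam / N)))))
            * ((∫ θ, empErr N f θ ω ∂(ρ ω)) + KL (ρ ω) π / lam) ∂P) := by
  have hN' : (0 : ℝ) < N := Nat.cast_pos.2 hN
  set e := Real.exp (-(lam / N))
  have he0 : 0 < e := Real.exp_pos _
  have he1 : e < 1 := Real.exp_lt_one_iff.2 (neg_lt_zero.2 (by positivity))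
  have hc : 0 < 1 - e := sub_pos.2 he1
  set X : (Fin N → 𝒳 × 𝒴) × Θ → ℝ := fun z => 1 - (1 - e) * expErr N P f z.2 with hX
  have hr := measurable_empErr (N := N) hf
  have hR : Measurable fun z : (Fin N → 𝒳 × 𝒴) × Θ => expErr N P f z.2 :=
    (measurable_expErr hf).comp measurable_snd
  have hXm : Measurable X := (hR.const_mul _).const_sub _
  have hXθ : ∀ θ, 1 - (1 - e) * expErr N P f θ ∈ Set.Icc e 1 := fun θ => by
    obtain ⟨h0, h1⟩ := expErr_mem_Icc (f := f) (P := P) θ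
    constructor <;> nlinarith
  have hXe : ∀ z, X z ∈ Set.Icc e 1 := fun z => hXθ z.2
  have hlogX : ∀ z, Real.log (X z) ∈ Set.Icc (Real.log e) 0 := fun z =>
    ⟨Real.log_le_log he0 (hXe z).1, Real.log_nonpos (he0.le.trans (hXe z).1) (hXe z).2⟩
  have hloge : Real.log e = -(lam / N) := Real.log_exp _
  have hrint : Integrable (fun z : (Fin N → 𝒳 × 𝒴) × Θ => empErr N f z.2 z.1) (P ⊗ₘ ρ) :=
    .of_mem_Icc 0 1 hr.aemeasurable (ae_of_all _ fun z => empErr_mem_Icc _ _)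
  have hRint : Integrable (fun z : (Fin N → 𝒳 × 𝒴) × Θ => expErr N P f z.2) (P ⊗ₘ ρ) :=
    .of_mem_Icc 0 1 hR.aemeasurable (ae_of_all _ fun z => expErr_mem_Icc _)
  have hLint : Integrable (fun z => Real.log (X z)) (P ⊗ₘ ρ) :=
    .of_mem_Icc _ 0 hXm.log.aemeasurable (ae_of_all _ hlogX)
  have hrP : Integrable (fun ω => ∫ θ, empErr N f θ ω ∂(ρ ω)) P := hrint.integral_measure_compProd
  set g : (Fin N → 𝒳 × 𝒴) × Θ → ℝ := fun z => -lam * empErr N f z.2 z.1 - N * Real.log (X z)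
    with hg
  have hgC : ∀ z, |g z| ≤ lam := fun z => by
    obtain ⟨h0, h1⟩ := empErr_mem_Icc (f := f) z.2 z.1
    obtain ⟨h2, h3⟩ := hlogX z
    have h4 : -lam ≤ N * Real.log (X z) := by
      have := mul_le_mul_of_nonneg_left h2 hN'.le
      rwa [hloge, mul_neg, mul_div_cancel₀ _ hN'.ne'] at this
    rw [abs_le]
    constructor <;> simp only [hg] <;> nlinarith
  have hgexp : ∀ θ, ∫ ω, Real.exp (g (ω, θ)) ∂P ≤ 1 := fun θ => by
    have hx : 0 < 1 - (1 - e) * expErr N P f θ := he0.trans_le (hXθ θ).1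
    have hsplit : ∀ ω, Real.exp (g (ω, θ)) = Real.exp (-lam * empErr N f θ ω)
        / (1 - (1 - e) * expErr N P f θ) ^ N := fun ω => by
      simp only [hg, hX]
      rw [Real.exp_sub, ← Real.log_pow, Real.exp_log (by positivity)]
    simp_rw [hsplit]
    rw [integral_div, div_le_one (by positivity)]
    subst hP
    exact integral_exp_neg_empErr_le hN hf hlam θ
  have hgm : Measurable g := (hr.const_mul _).sub (hXm.log.const_mul _)
  have hmain := integral_integral_le_integral_KL hρ hKLint hgm hgC hgexp
  have hgsplit : ∫ ω, ∫ θ, g (ω, θ) ∂(ρ ω) ∂P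
      = -lam * (∫ ω, ∫ θ, empErr N f θ ω ∂(ρ ω) ∂P) - N * ∫ z, Real.log (X z) ∂(P ⊗ₘ ρ) := by
    have hgint : Integrable g (P ⊗ₘ ρ) := (hrint.const_mul _).sub (hLint.const_mul _)
    rw [← Measure.integral_compProd hgint,
      integral_sub (hrint.const_mul _) (hLint.const_mul _), integral_const_mul,
      integral_const_mul, Measure.integral_compProd hrint]
  have hjensen := integral_log_le_log_integral (μ := P ⊗ₘ ρ) he0 hXm hXe
  have hXint : ∫ z, X z ∂(P ⊗ₘ ρ) = 1 - (1 - e) * ∫ ω, ∫ θ, expErr N P f θ ∂(ρ ω) ∂P := by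
    rw [integral_sub (integrable_const _) (hRint.const_mul _), integral_const_mul,
      Measure.integral_compProd hRint]
    simp
  have hXpos : 0 < ∫ z, X z ∂(P ⊗ₘ ρ) := by
    have hmono := integral_mono (integrable_const e)
      (Integrable.of_mem_Icc e 1 hXm.aemeasurable (ae_of_all (P ⊗ₘ ρ) hXe)) fun z => (hXe z).1
    simp only [integral_const, probReal_univ, one_smul] at hmono
    exact he0.trans_le hmono
  have hB : ∫ ω, (lam * (∫ θ, empErr N f θ ω ∂(ρ ω)) + KL (ρ ω) π) ∂P
      = lam * (∫ ω, ∫ θ, empErr N f θ ω ∂(ρ ω) ∂P) + ∫ ω, KL (ρ ω) π ∂P := by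
    rw [integral_add (hrP.const_mul _) hKLint, integral_const_mul]
  set B := ∫ ω, (lam * (∫ θ, empErr N f θ ω ∂(ρ ω)) + KL (ρ ω) π) ∂P with hBdef
  constructor
  · rw [le_div_iff₀ hc]
    have hexp : Real.exp (-(N : ℝ)⁻¹ * B) ≤ ∫ z, X z ∂(P ⊗ₘ ρ) := by
      rw [← Real.le_log_iff_exp_le hXpos]
      refine le_trans ?_ hjensen
      rw [neg_mul, inv_mul_eq_div, ← neg_div, div_le_iff₀ hN']
      linarith
    rw [hXint] at hexp
    linarith
  · have hrhs : ∀ ω, (lam / (N * (1 - e))) * ((∫ θ, empErr N f θ ω ∂(ρ ω)) + KL (ρ ω) π / lam)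
        = (N : ℝ)⁻¹ / (1 - e) * (lam * (∫ θ, empErr N f θ ω ∂(ρ ω)) + KL (ρ ω) π) := fun ω => by
      have := hc.ne'
      field_simp
    simp_rw [hrhs]
    rw [integral_const_mul, ← hBdef, div_mul_eq_mul_div]
    gcongr
    linarith [Real.add_one_le_exp (-(N : ℝ)⁻¹ * B)]
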